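/- arXiv:2311.00459 — 10 statements merged into one kernel-verified Lean document; each statement's English description precedes it below -/
import Mathlib

section
/- Let (A, ·) be a commutative associative ℂ-algebra and let D : A → A be a derivation, i.e. a linear map with D(x·y) = D(x)·y + x·D(y) for all x, y. Define [x,y] := D(x)·y − x·D(y). Then (A, ·, [·,·]) is a transposed Poisson algebra; in particular [·,·] is a Lie bracket on A and 2 z·[x,y] = [z·x, y] + [x, z·y] for all x, y, z ∈ A. -/
noncomputable section

def Bilinear {L : Type*} [AddCommGroup L] [Module ℂ L] (m : L → L → L) : Prop :=
  (∀ (a : ℂ) (x y z : L), m (a • x + y) z = a • m x z + m y z) ∧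
  (∀ (a : ℂ) (x y z : L), m x (a • y + z) = a • m x y + m x z)

namespace Bilinear

variable {L : Type*} [AddCommGroup L] [Module ℂ L] {m : L → L → L}

theorem add_left (h : Bilinear m) (x y z : L) : m (x + y) z = m x z + m y z := by
  simpa using h.1 1 x y z

theorem add_right (h : Bilinear m) (x y z : L) : m x (y + z) = m x y + m x z := by
  simpa using h.2 1 x y z

theorem sub_left (h : Bilinear m) (x y z : L) : m (x - y) z = m x z - m y z := by
  rw [eq_sub_iff_add_eq, ← h.add_left, sub_add_cancel]

theorem sub_right (h : Bilinear m) (x y z : L) : m x (y - z) = m x y - m x z := by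
  rw [eq_sub_iff_add_eq, ← h.add_right, sub_add_cancel]

end Bilinear

theorem statement1 {A : Type*} [AddCommGroup A] [Module ℂ A]
    (mul : A → A → A)
    (hmul : Bilinear mul)
    (hcomm : ∀ x y, mul x y = mul y x)
    (hassoc : ∀ x y z, mul (mul x y) z = mul x (mul y z))
    (D : A →ₗ[ℂ] A)
    (hD : ∀ x y, D (mul x y) = mul (D x) y + mul x (D y))
    (bracket : A → A → A)
    (hbracket : ∀ x y, bracket x y = mul (D x) y - mul x (D y)) :
    Bilinear bracket ∧
    (∀ x, bracket x x = 0) ∧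
    (∀ x y z, bracket (bracket x y) z + bracket (bracket y z) x + bracket (bracket z x) y = 0) ∧
    (∀ x y z, (2 : ℂ) • mul z (bracket x y) = bracket (mul z x) y + bracket x (mul z y)) := by
  have hleft : ∀ x y z, mul x (mul y z) = mul y (mul x z) := fun x y z => by
    rw [← hassoc, hcomm x y, hassoc]
  refine ⟨⟨fun a x y z => ?_, fun a x y z => ?_⟩, fun x => ?_, fun x y z => ?_, fun x y z => ?_⟩
  · simp only [hbracket, map_add, map_smul, hmul.1, smul_sub]
    abel
  · simp only [hbracket, map_add, map_smul, hmul.2, smul_sub]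
    abel
  · rw [hbracket, hcomm, sub_self]
  · simp only [hbracket, map_sub, hD, hmul.add_left, hmul.sub_left, hassoc, hcomm, hleft]
    abel
  · simp only [hbracket, hD, hmul.add_left, hmul.add_right, hmul.sub_right, hassoc, hcomm, hleft,
      two_smul]
    abel
end
end

section
/- Let (L, [·,·]) be a complex Lie algebra of dimension at least 2 such that every 1/2-derivation of L is a scalar multiple of the identity map. Then for every commutative associative bilinear multiplication · on L satisfying the compatibility condition 2 z·[x,y] = [z·x, y] + [x, z·y] for all x, y, z ∈ L, one has x·y = 0 for all x, y ∈ L. -/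
noncomputable section

def IsHalfDerivation {L : Type*} [AddCommGroup L] [Module ℂ L]
    (bracket : L → L → L) (φ : L → L) : Prop :=
  (∀ (a : ℂ) (x y : L), φ (a • x + y) = a • φ x + φ y) ∧
  (∀ x y : L, φ (bracket x y) = (1/2 : ℂ) • (bracket (φ x) y + bracket x (φ y)))

theorem exists_forall_smul_ne_of_two_le_rank {K V : Type*} [DivisionRing K] [AddCommGroup V]
    [Module K V] (h : 2 ≤ Module.rank K V) (x : V) : ∃ y : V, ∀ r : K, r • x ≠ y := by
  by_contra! hx
  exact absurd (h.trans (rank_le_one_iff.mpr ⟨x, hx⟩)) (by norm_num)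

theorem isHalfDerivation_mul_left {L : Type*} [AddCommGroup L] [Module ℂ L]
    {bracket mul : L → L → L} (hmul : Bilinear mul)
    (hcompat : ∀ x y z, (2 : ℂ) • mul z (bracket x y) = bracket (mul z x) y + bracket x (mul z y))
    (z : L) : IsHalfDerivation bracket (mul z) := by
  refine ⟨fun a x y => hmul.2 a z x y, fun x y => ?_⟩
  rw [← hcompat, smul_smul]
  norm_num

theorem statement2 {L : Type*} [AddCommGroup L] [Module ℂ L]
    (bracket : L → L → L)
    (hbr : Bilinear bracket)
    (halt : ∀ x, bracket x x = 0)
    (hjac : ∀ x y z, bracket (bracket x y) z + bracket (bracket y z) x + bracket (bracket z x) y = 0)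
    (hdim : 2 ≤ Module.rank ℂ L)
    (htriv : ∀ φ : L → L, IsHalfDerivation bracket φ → ∃ c : ℂ, ∀ x, φ x = c • x)
    (mul : L → L → L)
    (hmul : Bilinear mul)
    (hcomm : ∀ x y, mul x y = mul y x)
    (hassoc : ∀ x y z, mul (mul x y) z = mul x (mul y z))
    (hcompat : ∀ x y z, (2 : ℂ) • mul z (bracket x y) = bracket (mul z x) y + bracket x (mul z y)) :
    ∀ x y, mul x y = 0 := by
  intro x z
  have hscalar : ∀ w, ∃ c : ℂ, ∀ y, mul w y = c • y := fun w =>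
    htriv (mul w) (isHalfDerivation_mul_left hmul hcompat w)
  obtain ⟨y, hy⟩ := exists_forall_smul_ne_of_two_le_rank hdim x
  obtain ⟨c, hc⟩ := hscalar x
  obtain ⟨d, hd⟩ := hscalar y
  have hcd : c • y = d • x := by rw [← hc, ← hd, hcomm]
  have hc0 : c = 0 := by
    by_contra hne
    exact hy (c⁻¹ * d) (by rw [mul_smul, ← hcd, inv_smul_smul₀ hne])
  rw [hc, hc0, zero_smul]
end
end

section
/- A linear map φ : g₁ → g₁ is a 1/2-derivation of g₁ if and only if there exist scalars β₃₁, β₃₂, β₃₃ ∈ ℂ such that φ(e₁) = β₃₃ e₁, φ(e₂) = β₃₃ e₂ and φ(e₃) = β₃₁ e₁ + β₃₂ e₂ + β₃₃ e₃. -/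
noncomputable section

abbrev V3 : Type := Fin 3 → ℂ

def e (i : Fin 3) : V3 := Pi.single i 1

def bg1 : V3 → V3 → V3 := fun x y => ![(x 0 * y 2 - x 2 * y 0), (x 1 * y 2 - x 2 * y 1), (0 : ℂ)]

theorem statement3 (φ : V3 →ₗ[ℂ] V3) :
    (∀ x y, φ (bg1 x y) = (1/2 : ℂ) • (bg1 (φ x) y + bg1 x (φ y))) ↔
    (∃ β31 β32 β33 : ℂ,
      φ (e 0) = β33 • e 0 ∧
      φ (e 1) = β33 • e 1 ∧
      φ (e 2) = β31 • e 0 + β32 • e 1 + β33 • e 2) := by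
  have decomp (x : V3) : φ x = x 0 • φ (e 0) + x 1 • φ (e 1) + x 2 • φ (e 2) := by
    rw [← map_smul, ← map_smul, ← map_smul, ← map_add, ← map_add]
    congr 1
    ext i
    fin_cases i <;> simp [e]
  constructor
  · intro h
    have h02 : φ (e 0) = (1/2 : ℂ) • (bg1 (φ (e 0)) (e 2) + bg1 (e 0) (φ (e 2))) := by
      rw [← h]
      congr 1
      ext i
      fin_cases i <;> simp [e, bg1]
    have h12 : φ (e 1) = (1/2 : ℂ) • (bg1 (φ (e 1)) (e 2) + bg1 (e 1) (φ (e 2))) := by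
      rw [← h]
      congr 1
      ext i
      fin_cases i <;> simp [e, bg1]
    refine ⟨φ (e 2) 0, φ (e 2) 1, φ (e 2) 2, ?_, ?_, ?_⟩
    · generalize φ (e 0) = a at *
      ext i
      have hi := congrFun h02 i
      fin_cases i <;> simp [e, bg1] at hi ⊢ <;> grind
    · generalize φ (e 1) = a at *
      ext i
      have hi := congrFun h12 i
      fin_cases i <;> simp [e, bg1] at hi ⊢ <;> grind
    · ext i
      fin_cases i <;> simp [e]
  · rintro ⟨a, b, c, h0, h1, h2⟩ x y
    rw [decomp (bg1 x y), decomp x, decomp y, h0, h1, h2]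
    ext i
    fin_cases i <;> simp [e, bg1] <;> ring
end
end

section
/- A linear map φ : g₁ → g₁ is a Lie algebra automorphism of g₁ if and only if there exist scalars λ₁₁, λ₁₂, λ₁₃, λ₂₁, λ₂₂, λ₂₃ ∈ ℂ with λ₁₁λ₂₂ − λ₂₁λ₁₂ ≠ 0 such that φ(e₁) = λ₁₁ e₁ + λ₂₁ e₂, φ(e₂) = λ₁₂ e₁ + λ₂₂ e₂ and φ(e₃) = λ₁₃ e₁ + λ₂₃ e₂ + e₃. -/
noncomputable section

theorem eq_sum_smul_e (x : V3) : x = x 0 • e 0 + x 1 • e 1 + x 2 • e 2 := by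
  ext i
  fin_cases i <;> simp [e]

theorem map_eq_sum_smul (φ : V3 →ₗ[ℂ] V3) (x : V3) :
    φ x = x 0 • φ (e 0) + x 1 • φ (e 1) + x 2 • φ (e 2) := by
  conv_lhs => rw [eq_sum_smul_e x]
  simp only [map_add, map_smul]

theorem bg1_e_zero_e_two : bg1 (e 0) (e 2) = e 0 := by
  ext i
  fin_cases i <;> simp [bg1, e]

theorem bg1_e_one_e_two : bg1 (e 1) (e 2) = e 1 := by
  ext i
  fin_cases i <;> simp [bg1, e]

theorem statement4 (φ : V3 →ₗ[ℂ] V3) :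
    (Function.Bijective φ ∧ ∀ x y, φ (bg1 x y) = bg1 (φ x) (φ y)) ↔
    (∃ l11 l12 l13 l21 l22 l23 : ℂ, l11 * l22 - l21 * l12 ≠ 0 ∧
      φ (e 0) = l11 • e 0 + l21 • e 1 ∧
      φ (e 1) = l12 • e 0 + l22 • e 1 ∧
      φ (e 2) = l13 • e 0 + l23 • e 1 + e 2) := by
  constructor
  · rintro ⟨⟨hinj, -⟩, hbr⟩
    have h0 := hbr (e 0) (e 2)
    have h1 := hbr (e 1) (e 2)
    rw [bg1_e_zero_e_two] at h0
    rw [bg1_e_one_e_two] at h1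
    have h02 : φ (e 0) 2 = 0 := by simpa [bg1] using congrFun h0 2
    have h12 : φ (e 1) 2 = 0 := by simpa [bg1] using congrFun h1 2
    have h00 : φ (e 0) 0 = φ (e 0) 0 * φ (e 2) 2 := by
      simpa [bg1, h02] using congrFun h0 0
    have h01 : φ (e 0) 1 = φ (e 0) 1 * φ (e 2) 2 := by
      simpa [bg1, h02] using congrFun h0 1
    have hne : ¬ (φ (e 0) 0 = 0 ∧ φ (e 0) 1 = 0) := by
      rintro ⟨ha, hb⟩
      have hz : φ (e 0) = φ 0 := by
        rw [map_zero]
        ext i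
        fin_cases i <;> simp [ha, hb, h02]
      simpa [e] using congrFun (hinj hz) 0
    have h22 : φ (e 2) 2 = 1 := by
      by_contra h
      have h' : 1 - φ (e 2) 2 ≠ 0 := sub_ne_zero.mpr (Ne.symm h)
      exact hne ⟨(mul_eq_zero.mp (by linear_combination h00 :
          φ (e 0) 0 * (1 - φ (e 2) 2) = 0)).resolve_right h',
        (mul_eq_zero.mp (by linear_combination h01 :
          φ (e 0) 1 * (1 - φ (e 2) 2) = 0)).resolve_right h'⟩
    refine ⟨φ (e 0) 0, φ (e 1) 0, φ (e 2) 0, φ (e 0) 1, φ (e 1) 1, φ (e 2) 1, ?_, ?_, ?_, ?_⟩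
    · intro hdet
      have k1 : φ (φ (e 1) 1 • e 0 - φ (e 0) 1 • e 1) = φ 0 := by
        rw [map_sub, map_smul, map_smul, map_zero]
        ext i
        fin_cases i
        · simp only [Fin.zero_eta, Pi.sub_apply, Pi.smul_apply, smul_eq_mul, Pi.zero_apply]
          linear_combination hdet
        · simp only [Fin.mk_one, Pi.sub_apply, Pi.smul_apply, smul_eq_mul, Pi.zero_apply]
          ring
        · simp [h02, h12]
      have k2 : φ (φ (e 1) 0 • e 0 - φ (e 0) 0 • e 1) = φ 0 := by
        rw [map_sub, map_smul, map_smul, map_zero]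
        ext i
        fin_cases i
        · simp only [Fin.zero_eta, Pi.sub_apply, Pi.smul_apply, smul_eq_mul, Pi.zero_apply]
          ring
        · simp only [Fin.mk_one, Pi.sub_apply, Pi.smul_apply, smul_eq_mul, Pi.zero_apply]
          linear_combination -hdet
        · simp [h02, h12]
      exact hne ⟨by simpa [e] using congrFun (hinj k2) 1, by simpa [e] using congrFun (hinj k1) 1⟩
    · simpa [h02] using eq_sum_smul_e (φ (e 0))
    · simpa [h12] using eq_sum_smul_e (φ (e 1))
    · simpa [h22] using eq_sum_smul_e (φ (e 2))
  · rintro ⟨a, b, c, d, f, g, hdet, h0, h1, h2⟩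
    have hφ : ∀ x, φ x = ![a * x 0 + b * x 1 + c * x 2, d * x 0 + f * x 1 + g * x 2, x 2] := by
      intro x
      rw [map_eq_sum_smul φ x, h0, h1, h2]
      ext i
      fin_cases i <;> simp [e] <;> ring
    have hinj : Function.Injective φ := by
      rw [← LinearMap.ker_eq_bot, LinearMap.ker_eq_bot']
      intro x hx
      rw [hφ] at hx
      have x2 : x 2 = 0 := by simpa using congrFun hx 2
      have y0 : a * x 0 + b * x 1 = 0 := by simpa [x2] using congrFun hx 0
      have y1 : d * x 0 + f * x 1 = 0 := by simpa [x2] using congrFun hx 1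
      have x0 : x 0 = 0 := (mul_eq_zero.mp (by linear_combination f * y0 - b * y1 :
        (a * f - d * b) * x 0 = 0)).resolve_left hdet
      have x1 : x 1 = 0 := (mul_eq_zero.mp (by linear_combination a * y1 - d * y0 :
        (a * f - d * b) * x 1 = 0)).resolve_left hdet
      ext i
      fin_cases i <;> simp [x0, x1, x2]
    refine ⟨⟨hinj, LinearMap.injective_iff_surjective.mp hinj⟩, fun x y => ?_⟩
    rw [hφ, hφ x, hφ y]
    ext i
    fin_cases i <;> simp [bg1] <;> ring
end
end

section
/- Let · be a commutative associative bilinear multiplication on g₁ such that (g₁, ·, [·,·]) satisfies the transposed Poisson compatibility condition 2 z·[x,y] = [z·x, y] + [x, z·y]. Then (g₁, ·, [·,·]) is isomorphic to exactly one of the following transposed Poisson algebras (only nonzero products listed, on a basis e₁,e₂,e₃ with bracket [e₁,e₃]=e₁, [e₂,e₃]=e₂): T₀₇^α (α ∈ ℂ): e₁·e₃ = α e₁, e₂·e₃ = α e₂, e₃·e₃ = α e₃; or T₀₈: e₃·e₃ = e₁. Moreover, T₀₇^α ≅ T₀₇^{α'} only when α = α', and T₀₇^α ≇ T₀₈ for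 all α. -/
noncomputable section

def IsoPair {L M : Type*} [AddCommGroup L] [Module ℂ L] [AddCommGroup M] [Module ℂ M]
    (m₁ b₁ : L → L → L) (m₂ b₂ : M → M → M) : Prop :=
  ∃ φ : L ≃ₗ[ℂ] M, (∀ x y, φ (m₁ x y) = m₂ (φ x) (φ y)) ∧ (∀ x y, φ (b₁ x y) = b₂ (φ x) (φ y))

def mT07 (β : ℂ) : V3 → V3 → V3 := fun x y => ![(β * (x 0 * y 2 + x 2 * y 0)), (β * (x 1 * y 2 + x 2 * y 1)), (β * (x 2 * y 2))]

def mT08 : V3 → V3 → V3 := fun x y => ![(x 2 * y 2), (0 : ℂ), (0 : ℂ)]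

theorem Bilinear.apply_eq_sum {m : V3 → V3 → V3} (hm : Bilinear m) (x y : V3) :
    m x y = ∑ i, ∑ j, (x i * y j) • m (e i) (e j) := by
  let B : V3 →ₗ[ℂ] V3 →ₗ[ℂ] V3 := LinearMap.mk₂ ℂ m
    (fun x y z => by simpa using hm.1 1 x y z)
    (fun c x z => by
      have h0 : m 0 z = 0 := by simpa using hm.1 1 0 0 z
      simpa [h0] using hm.1 c x 0 z)
    (fun x y z => by simpa using hm.2 1 x y z)
    (fun c x y => by
      have h0 : m x 0 = 0 := by simpa using hm.2 1 x 0 0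
      simpa [h0] using hm.2 c x y 0)
  have hsum (v : V3) : v = ∑ i, v i • e i := by
    ext k
    simp [e, Pi.single_apply]
  change B x y = ∑ i, ∑ j, (x i * y j) • B (e i) (e j)
  conv_lhs => rw [hsum x, hsum y]
  simp only [map_sum, LinearMap.sum_apply, map_smul, LinearMap.smul_apply, Finset.smul_sum,
    smul_smul]
  rw [Finset.sum_comm]
  simp only [mul_comm]

/-- The commutative multiplications on `g₁` that are compatible with the bracket. -/
def compatibleMul (α a b : ℂ) : V3 → V3 → V3 := fun x y =>
  ![α * (x 0 * y 2 + x 2 * y 0) + a * (x 2 * y 2),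
    α * (x 1 * y 2 + x 2 * y 1) + b * (x 2 * y 2), α * (x 2 * y 2)]

theorem Bilinear.exists_eq_compatibleMul {m : V3 → V3 → V3} (hm : Bilinear m)
    (hcomm : ∀ x y, m x y = m y x)
    (hcompat : ∀ x y z, (2 : ℂ) • m z (bg1 x y) = bg1 (m z x) y + bg1 x (m z y)) :
    ∃ α a b : ℂ, m = compatibleMul α a b := by
  have h01 : bg1 (e 0) (e 1) = 0 := by ext k; fin_cases k <;> simp [bg1, e]
  have h02 : bg1 (e 0) (e 2) = e 0 := by ext k; fin_cases k <;> simp [bg1, e]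
  have h12 : bg1 (e 1) (e 2) = e 1 := by ext k; fin_cases k <;> simp [bg1, e]
  have hm0 (z : V3) : m z 0 = 0 := by simpa using hm.2 1 z 0 0
  have third (z : V3) : m z (e 0) 2 = 0 ∧ m z (e 1) 2 = 0 := by
    have h := hcompat (e 0) (e 1) z
    rw [h01, hm0] at h
    have h0 := congrFun h 0
    have h1 := congrFun h 1
    simp [bg1, e] at h0 h1
    exact ⟨h1, h0.symm⟩
  have he0 (z : V3) : m z (e 0) = m z (e 2) 2 • e 0 := by
    have h := hcompat (e 0) (e 2) z
    rw [h02] at h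
    have h0 := congrFun h 0
    have h1 := congrFun h 1
    simp [bg1, e] at h0 h1
    ext k
    fin_cases k
    · simp [e]; linear_combination h0
    · simp [e]; linear_combination h1
    · simpa [e] using (third z).1
  have he1 (z : V3) : m z (e 1) = m z (e 2) 2 • e 1 := by
    have h := hcompat (e 1) (e 2) z
    rw [h12] at h
    have h0 := congrFun h 0
    have h1 := congrFun h 1
    simp [bg1, e] at h0 h1
    ext k
    fin_cases k
    · simp [e]; linear_combination h0
    · simp [e]; linear_combination h1
    · simpa [e] using (third z).2
  have d0 : m (e 0) (e 2) 2 = 0 := by rw [hcomm]; exact (third _).1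
  have d1 : m (e 1) (e 2) 2 = 0 := by rw [hcomm]; exact (third _).2
  refine ⟨m (e 2) (e 2) 2, m (e 2) (e 2) 0, m (e 2) (e 2) 1, ?_⟩
  funext x y
  rw [hm.apply_eq_sum]
  simp only [Fin.sum_univ_three, hcomm (e 0) (e 2), hcomm (e 1) (e 2), he0, he1, d0, d1]
  ext k
  fin_cases k <;> simp [compatibleMul, e] <;> ring

theorem isoPair_compatibleMul_mT07 {α : ℂ} (hα : α ≠ 0) (a b : ℂ) :
    IsoPair (compatibleMul α a b) bg1 (mT07 α) bg1 := by
  refine ⟨{ toFun := fun x => ![x 0 + a / α * x 2, x 1 + b / α * x 2, x 2]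
            invFun := fun x => ![x 0 - a / α * x 2, x 1 - b / α * x 2, x 2]
            map_add' := fun x y => ?_
            map_smul' := fun c x => ?_
            left_inv := fun x => ?_
            right_inv := fun x => ?_ }, fun x y => ?_, fun x y => ?_⟩ <;>
    ext k <;> fin_cases k <;> simp [compatibleMul, mT07, bg1] <;> field_simp <;> ring

theorem isoPair_compatibleMul_mT08_of_left {a : ℂ} (ha : a ≠ 0) (b : ℂ) :
    IsoPair (compatibleMul 0 a b) bg1 mT08 bg1 := by
  refine ⟨{ toFun := fun x => ![x 0 / a, x 1 - b / a * x 0, x 2]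
            invFun := fun x => ![a * x 0, x 1 + b * x 0, x 2]
            map_add' := fun x y => ?_
            map_smul' := fun c x => ?_
            left_inv := fun x => ?_
            right_inv := fun x => ?_ }, fun x y => ?_, fun x y => ?_⟩ <;>
    ext k <;> fin_cases k <;> simp [compatibleMul, mT08, bg1] <;> field_simp <;> ring

theorem isoPair_compatibleMul_mT08_of_right {b : ℂ} (hb : b ≠ 0) :
    IsoPair (compatibleMul 0 0 b) bg1 mT08 bg1 := by
  refine ⟨{ toFun := fun x => ![x 1 / b, x 0, x 2]
            invFun := fun x => ![x 1, b * x 0, x 2]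
            map_add' := fun x y => ?_
            map_smul' := fun c x => ?_
            left_inv := fun x => ?_
            right_inv := fun x => ?_ }, fun x y => ?_, fun x y => ?_⟩ <;>
    ext k <;> fin_cases k <;> simp [compatibleMul, mT08, bg1] <;> field_simp

theorem compatibleMul_zero_zero (α : ℂ) : compatibleMul α 0 0 = mT07 α := by
  funext x y
  simp [compatibleMul, mT07]

theorem apply_e_two_of_map_bg1 (φ : V3 ≃ₗ[ℂ] V3)
    (hφ : ∀ x y, φ (bg1 x y) = bg1 (φ x) (φ y)) : φ (e 2) 2 = 1 := by
  have h02 : bg1 (e 0) (e 2) = e 0 := by ext k; fin_cases k <;> simp [bg1, e]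
  have h := hφ (e 0) (e 2)
  rw [h02] at h
  have h2 : φ (e 0) 2 = 0 := by simpa [bg1] using congrFun h 2
  have h0 := congrFun h 0
  have h1 := congrFun h 1
  simp [bg1, h2] at h0 h1
  by_contra hne
  have key (c : ℂ) (hc : c = c * φ (e 2) 2) : c = 0 := by
    by_contra h
    exact hne (mul_left_cancel₀ h (by rw [mul_one]; exact hc.symm))
  have hzero : φ (e 0) = 0 := by
    ext k
    fin_cases k
    · exact key _ h0
    · exact key _ h1
    · exact h2
  have := congrFun (φ.map_eq_zero_iff.mp hzero) 0
  simp [e] at this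

theorem mT07_e_two (α : ℂ) : mT07 α (e 2) (e 2) = α • e 2 := by
  ext k
  fin_cases k <;> simp [mT07, e]

theorem statement5 (m : V3 → V3 → V3)
    (hm : Bilinear m)
    (hcomm : ∀ x y, m x y = m y x)
    (hassoc : ∀ x y z, m (m x y) z = m x (m y z))
    (hcompat : ∀ x y z, (2 : ℂ) • m z (bg1 x y) = bg1 (m z x) y + bg1 x (m z y)) :
    ((∃ α : ℂ, IsoPair m bg1 (mT07 α) bg1) ∨ IsoPair m bg1 mT08 bg1) ∧
    (∀ α α' : ℂ, IsoPair (mT07 α) bg1 (mT07 α') bg1 → α = α') ∧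
    (∀ α : ℂ, ¬ IsoPair (mT07 α) bg1 mT08 bg1) := by
  refine ⟨?_, ?_, ?_⟩
  · obtain ⟨α, a, b, rfl⟩ := hm.exists_eq_compatibleMul hcomm hcompat
    by_cases hα : α = 0
    · subst hα
      by_cases ha : a = 0
      · subst ha
        by_cases hb : b = 0
        · subst hb
          exact .inl ⟨0, .refl ℂ V3, by simp [compatibleMul_zero_zero], by simp⟩
        · exact .inr (isoPair_compatibleMul_mT08_of_right hb)
      · exact .inr (isoPair_compatibleMul_mT08_of_left ha b)
    · exact .inl ⟨α, isoPair_compatibleMul_mT07 hα a b⟩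
  · rintro α α' ⟨φ, hmul, hbr⟩
    have h := congrFun (hmul (e 2) (e 2)) 2
    rw [mT07_e_two, map_smul] at h
    simpa [mT07, apply_e_two_of_map_bg1 φ hbr] using h
  · rintro α ⟨φ, hmul, hbr⟩
    have h := hmul (e 2) (e 2)
    rw [mT07_e_two, map_smul] at h
    have hα : α = 0 := by
      simpa [mT08, apply_e_two_of_map_bg1 φ hbr] using congrFun h 2
    simpa [mT08, hα, apply_e_two_of_map_bg1 φ hbr] using congrFun h 0
end
end

section
/- Let · be a nonzero commutative associative bilinear multiplication on g₁ such that (g₁, ·, [·,·]) satisfies the transposed Poisson compatibility condition 2 z·[x,y] = [z·x, y] + [x, z·y]. Then (g₁, ·, [·,·]) is not a Poisson algebra: there exist x, y, z ∈ g₁ such that [x·y, z] ≠ x·[y,z] + [x,z]·y. -/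
noncomputable section

theorem bg1_swap (x y : V3) : bg1 x y = -bg1 y x := by
  ext i
  fin_cases i <;> simp [bg1] <;> ring

theorem eq_zero_of_forall_bg1_eq_zero {w : V3} (h : ∀ z, bg1 w z = 0) : w = 0 := by
  have h0 := congrFun (h (e 2)) 0
  have h1 := congrFun (h (e 2)) 1
  have h2 := congrFun (h (e 0)) 0
  simp [bg1, e] at h0 h1 h2
  ext i
  fin_cases i <;> simp [h0, h1, h2]

theorem Bilinear.map_neg_right {L : Type*} [AddCommGroup L] [Module ℂ L] {m : L → L → L}
    (hm : Bilinear m) (x y : L) : m x (-y) = -m x y := by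
  have h0 : m x 0 = 0 := by simpa using hm.2 1 x 0 0
  simpa [h0] using hm.2 (-1) x y 0

theorem statement6 (m : V3 → V3 → V3)
    (hm : Bilinear m)
    (hcomm : ∀ x y, m x y = m y x)
    (hassoc : ∀ x y z, m (m x y) z = m x (m y z))
    (hcompat : ∀ x y z, (2 : ℂ) • m z (bg1 x y) = bg1 (m z x) y + bg1 x (m z y))
    (hnz : ∃ x y, m x y ≠ 0) :
    ∃ x y z : V3, bg1 (m x y) z ≠ m x (bg1 y z) + m (bg1 x z) y := by
  by_contra! leibniz
  have hsymm : ∀ x y z, m x (bg1 y z) = m y (bg1 x z) := by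
    intro x y z
    have h := hcompat x y z
    rw [leibniz z x y, bg1_swap x (m z y), leibniz z y x, bg1_swap y x, bg1_swap z x,
      hm.map_neg_right, hcomm (bg1 z y) x, hcomm (-bg1 x z) y, hm.map_neg_right,
      bg1_swap z y, hm.map_neg_right] at h
    linear_combination (norm := module) h
  have hanti : ∀ x y z, m x (bg1 y z) = -m x (bg1 z y) := by
    intro x y z
    rw [bg1_swap y z, hm.map_neg_right]
  have hzero : ∀ x y z, m x (bg1 y z) = 0 := by
    intro x y z
    have h : m x (bg1 y z) = -m x (bg1 y z) := by
      calc m x (bg1 y z) = -m y (bg1 z x) := by rw [hsymm, hanti]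
        _ = m z (bg1 x y) := by rw [hsymm, hanti, neg_neg]
        _ = -m x (bg1 y z) := by rw [hsymm, hanti]
    exact self_eq_neg.mp h
  obtain ⟨x, y, hxy⟩ := hnz
  refine hxy (eq_zero_of_forall_bg1_eq_zero fun z => ?_)
  rw [leibniz, hcomm (bg1 x z) y, hzero, hzero, add_zero]
end
end

section
/- Let φ be a 1/2-derivation of g₂^α. Then there exist scalars (denoted β with subscripts) such that: (1) if α ∉ {0, 1/2, 2}, then φ(e₁) = β₃₃ e₁, φ(e₂) = β₃₃ e₂, φ(e₃) = β₃₁ e₁ + β₃₂ e₂ + β₃₃ e₃; (2) if α = 1/2, then φ(e₁) = (β₃₃ − 2β₂₁) e₁ − 4β₂₁ e₂, φ(e₂) = β₂₁ e₁ + (2β₂₁ + β₃₃) e₂, φ(e₃) = β₃₁ e₁ + β₃₂ e₂ + β₃₃ e₃; (3) if α = 2, then φ(e₁) = β₃₃ e₁ + β₁₂ e₂, φ(e₂) = β₃₃ e₂, φ(e₃) = β₃₁ e₁ + β₃₂ e₂ + β₃₃ e₃; (4) if α = 0, then φ(e₁) = β₃₃ e₁ − (β₂₂ − β₃₃) e₂,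 φ(e₂) = β₂₂ e₂, φ(e₃) = β₃₁ e₁ + β₃₂ e₂ + β₃₃ e₃. -/
noncomputable section

def bg2 (α : ℂ) : V3 → V3 → V3 := fun x y => ![(x 0 * y 2 - x 2 * y 0), (x 0 * y 2 - x 2 * y 0) + (α * (x 1 * y 2 - x 2 * y 1)), (0 : ℂ)]

/-- The matrix-entry equations satisfied by a 1/2-derivation of `bg2 α`. -/
lemma entries_of_halfDerivation (α : ℂ) (φ : V3 →ₗ[ℂ] V3)
    (hφ : ∀ x y, φ (bg2 α x y) = (1/2 : ℂ) • (bg2 α (φ x) y + bg2 α x (φ y))) :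
    φ (e 0) 2 = 0 ∧ φ (e 1) 2 = 0 ∧
    φ (e 0) 0 + φ (e 1) 0 = (φ (e 0) 0 + φ (e 2) 2) / 2 ∧
    φ (e 0) 1 + φ (e 1) 1 = (φ (e 0) 0 + α * φ (e 0) 1 + φ (e 2) 2) / 2 ∧
    α * φ (e 1) 0 = φ (e 1) 0 / 2 ∧
    α * φ (e 1) 1 = (φ (e 1) 0 + α * φ (e 1) 1 + α * φ (e 2) 2) / 2 := by
  have h01 : bg2 α (e 0) (e 1) = 0 := by
    ext i; fin_cases i <;> simp [bg2, e]
  have h02 : bg2 α (e 0) (e 2) = e 0 + e 1 := by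
    ext i; fin_cases i <;> simp [bg2, e]
  have h12 : bg2 α (e 1) (e 2) = α • e 1 := by
    ext i; fin_cases i <;> simp [bg2, e]
  have H01 := hφ (e 0) (e 1)
  have H02 := hφ (e 0) (e 2)
  have H12 := hφ (e 1) (e 2)
  rw [h01, map_zero] at H01
  rw [h02, map_add] at H02
  rw [h12, map_smul] at H12
  have p0 := congrFun H01 0
  have q0 := congrFun H02 0
  have q1 := congrFun H02 1
  have q2 := congrFun H02 2
  have r0 := congrFun H12 0
  have r1 := congrFun H12 1
  simp [bg2, e] at p0 q0 q1 q2 r0 r1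
  simp only [e]
  refine ⟨?_, ?_, ?_, ?_, ?_, ?_⟩ <;> grind

theorem statement7 (α : ℂ) (φ : V3 →ₗ[ℂ] V3)
    (hφ : ∀ x y, φ (bg2 α x y) = (1/2 : ℂ) • (bg2 α (φ x) y + bg2 α x (φ y))) :
    (α ≠ 0 ∧ α ≠ 1/2 ∧ α ≠ 2 →
      ∃ β31 β32 β33 : ℂ,
        φ (e 0) = β33 • e 0 ∧
        φ (e 1) = β33 • e 1 ∧
        φ (e 2) = β31 • e 0 + β32 • e 1 + β33 • e 2) ∧
    (α = 1/2 →
      ∃ β21 β31 β32 β33 : ℂ,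
        φ (e 0) = (β33 - 2 * β21) • e 0 - (4 * β21) • e 1 ∧
        φ (e 1) = β21 • e 0 + (2 * β21 + β33) • e 1 ∧
        φ (e 2) = β31 • e 0 + β32 • e 1 + β33 • e 2) ∧
    (α = 2 →
      ∃ β12 β31 β32 β33 : ℂ,
        φ (e 0) = β33 • e 0 + β12 • e 1 ∧
        φ (e 1) = β33 • e 1 ∧
        φ (e 2) = β31 • e 0 + β32 • e 1 + β33 • e 2) ∧
    (α = 0 →
      ∃ β22 β31 β32 β33 : ℂ,
        φ (e 0) = β33 • e 0 - (β22 - β33) • e 1 ∧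
        φ (e 1) = β22 • e 1 ∧
        φ (e 2) = β31 • e 0 + β32 • e 1 + β33 • e 2) := by
  obtain ⟨ha2, hb2, q0, q1, r0, r1⟩ := entries_of_halfDerivation α φ hφ
  have expand (v : V3) : v = v 0 • e 0 + v 1 • e 1 + v 2 • e 2 := by
    ext i; fin_cases i <;> simp [e]
  have h0 := expand (φ (e 0))
  have h1 := expand (φ (e 1))
  have h2 := expand (φ (e 2))
  rw [ha2, zero_smul, add_zero] at h0
  rw [hb2, zero_smul, add_zero] at h1
  generalize φ (e 0) 0 = a0 at *
  generalize φ (e 0) 1 = a1 at *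
  generalize φ (e 1) 0 = b0 at *
  generalize φ (e 1) 1 = b1 at *
  generalize φ (e 2) 0 = c0 at *
  generalize φ (e 2) 1 = c1 at *
  generalize φ (e 2) 2 = c2 at *
  refine ⟨?_, ?_, ?_, ?_⟩
  · rintro ⟨hα0, hα1, hα2⟩
    have hb0 : b0 = 0 := by grind
    have hb1 : b1 = c2 := by
      apply mul_left_cancel₀ hα0
      linear_combination 2 * r1 + hb0
    have ha0 : a0 = c2 := by linear_combination 2 * q0 - 2 * hb0
    have ha1 : a1 = 0 := by
      apply mul_left_cancel₀ (sub_ne_zero.mpr hα2)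
      linear_combination -2 * q1 + 2 * hb1 - ha0
    refine ⟨c0, c1, c2, ?_, ?_, h2⟩
    · rw [h0, ha0, ha1]; module
    · rw [h1, hb0, hb1]; module
  · rintro rfl
    have hb1 : b1 = 2 * b0 + c2 := by linear_combination 4 * r1
    have ha0 : a0 = c2 - 2 * b0 := by linear_combination 2 * q0
    have ha1 : a1 = -(4 * b0) := by
      linear_combination (4 / 3) * q1 - (4 / 3) * hb1 + (2 / 3) * ha0
    refine ⟨b0, c0, c1, c2, ?_, ?_, h2⟩
    · rw [h0, ha0, ha1]; module
    · rw [h1, hb1]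
  · rintro rfl
    have hb0 : b0 = 0 := by linear_combination (2 / 3) * r0
    have hb1 : b1 = c2 := by linear_combination r1 + hb0 / 2
    have ha0 : a0 = c2 := by linear_combination 2 * q0 - 2 * hb0
    refine ⟨a1, c0, c1, c2, ?_, ?_, h2⟩
    · rw [h0, ha0]
    · rw [h1, hb0, hb1]; module
  · rintro rfl
    have hb0 : b0 = 0 := by linear_combination -2 * r0
    have ha0 : a0 = c2 := by linear_combination 2 * q0 - 2 * hb0
    have ha1 : a1 = -(b1 - c2) := by linear_combination q1 + ha0 / 2
    refine ⟨b1, c0, c1, c2, ?_, ?_, h2⟩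
    · rw [h0, ha0, ha1]; module
    · rw [h1, hb0]; module
end
end

section
/- For α₁, α₂, β₁, β₂ ∈ ℂ, the transposed Poisson algebras T₀₉^{α₁,β₁} and T₀₉^{α₂,β₂} are isomorphic if and only if (α₂, β₂) = (α₁, β₁), or α₁ ≠ 0 and (α₂, β₂) = (1/α₁, β₁/α₁). -/
noncomputable section

def mT09 (β : ℂ) : V3 → V3 → V3 := fun x y => ![(β * (x 0 * y 2 + x 2 * y 0)), (β * (x 1 * y 2 + x 2 * y 1)), (β * (x 2 * y 2))]

/-- The coordinate change carrying `T₀₉^{α,β}` to `T₀₉^{1/α,β/α}`. -/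
def invEquiv (α : ℂ) (hα : α ≠ 0) : V3 ≃ₗ[ℂ] V3 where
  toFun x := ![x 0 + (α - 1) * x 1, α * x 1, α * x 2]
  invFun y := ![y 0 - (α - 1) / α * y 1, y 1 / α, y 2 / α]
  map_add' x y := by
    ext i; fin_cases i <;> simp <;> ring
  map_smul' c x := by
    ext i; fin_cases i <;> simp <;> ring
  left_inv x := by
    ext i; fin_cases i <;> simp <;> field_simp
    ring
  right_inv y := by
    ext i; fin_cases i <;> simp <;> field_simp
    ring

theorem isoPair_inv (α β : ℂ) (hα : α ≠ 0) :
    IsoPair (mT09 β) (bg2 α) (mT09 (β / α)) (bg2 (1 / α)) := by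
  refine ⟨invEquiv α hα, fun x y => ?_, fun x y => ?_⟩
  · ext i; fin_cases i <;> simp [invEquiv, mT09] <;> field_simp
    ring
  · ext i; fin_cases i <;> simp [invEquiv, bg2] <;> field_simp <;> ring

theorem linearEquiv_apply_eq (φ : V3 ≃ₗ[ℂ] V3) (x : V3) (i : Fin 3) :
    φ x i = x 0 * φ (e 0) i + x 1 * φ (e 1) i + x 2 * φ (e 2) i := by
  have hx : x = x 0 • e 0 + x 1 • e 1 + x 2 • e 2 := by
    ext j; fin_cases j <;> simp [e]
  conv_lhs => rw [hx]
  simp only [map_add, map_smul, Pi.add_apply, Pi.smul_apply, smul_eq_mul]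

/-- A Lie isomorphism preserves the plane spanned by `e 0` and `e 1`. -/
theorem apply_e_two_eq_zero {α₁ α₂ : ℂ} (φ : V3 ≃ₗ[ℂ] V3)
    (hb : ∀ x y, φ (bg2 α₁ x y) = bg2 α₂ (φ x) (φ y)) :
    φ (e 0) 2 = 0 ∧ φ (e 1) 2 = 0 := by
  have h02 := congrFun (hb (e 0) (e 2)) 2
  have h12 := congrFun (hb (e 1) (e 2)) 2
  rw [linearEquiv_apply_eq] at h02 h12
  simp [bg2, e] at h02 h12
  have key : φ (e 1) 2 = 0 := by
    rcases h12 with rfl | h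
    · obtain ⟨x, hx⟩ := φ.surjective (e 0)
      have h := congrFun (hb x (e 1)) 0
      rw [hx, linearEquiv_apply_eq] at h
      simpa [bg2, e] using h.symm
    · exact h
  refine ⟨?_, key⟩
  change φ (e 0) 2 + φ (e 1) 2 = 0 at h02
  simpa [key] using h02

theorem planar_det_ne_zero (φ : V3 ≃ₗ[ℂ] V3) (h0 : φ (e 0) 2 = 0) (h1 : φ (e 1) 2 = 0) :
    φ (e 0) 0 * φ (e 1) 1 - φ (e 0) 1 * φ (e 1) 0 ≠ 0 := by
  intro hD
  have zero (u v : ℂ) (p : u * φ (e 0) 0 + v * φ (e 1) 0 = 0)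
      (q : u * φ (e 0) 1 + v * φ (e 1) 1 = 0) : u = 0 ∧ v = 0 := by
    have h : (![u, v, 0] : V3) = 0 := by
      apply φ.injective
      rw [map_zero]
      ext i
      rw [linearEquiv_apply_eq]
      fin_cases i <;> simp [p, q, h0, h1]
    exact ⟨by simpa using congrFun h 0, by simpa using congrFun h 1⟩
  have h₁ := zero (φ (e 1) 1) (-φ (e 0) 1) (by linear_combination hD) (by ring)
  have h₂ := zero (φ (e 1) 0) (-φ (e 0) 0) (by ring) (by linear_combination -hD)
  have h₃ := zero 0 1 (by simp [h₂.1]) (by simp [h₁.1])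
  exact one_ne_zero h₃.2

theorem params_of_isoPair {α₁ α₂ β₁ β₂ : ℂ}
    (h : IsoPair (mT09 β₁) (bg2 α₁) (mT09 β₂) (bg2 α₂)) :
    (α₂ = α₁ ∧ β₂ = β₁) ∨ (α₁ ≠ 0 ∧ α₂ = 1 / α₁ ∧ β₂ = β₁ / α₁) := by
  obtain ⟨φ, hm, hb⟩ := h
  obtain ⟨h0, h1⟩ := apply_e_two_eq_zero φ hb
  have hD := planar_det_ne_zero φ h0 h1
  have hc : φ (e 2) 2 ≠ 0 := by
    obtain ⟨x, hx⟩ := φ.surjective (e 2)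
    have h := congrFun hx 2
    intro hc
    rw [linearEquiv_apply_eq, h0, h1, hc] at h
    simp [e] at h
  have e1 := congrFun (hb (e 0) (e 2)) 0
  have e2 := congrFun (hb (e 0) (e 2)) 1
  have e3 := congrFun (hb (e 1) (e 2)) 0
  have e4 := congrFun (hb (e 1) (e 2)) 1
  have e5 := congrFun (hm (e 2) (e 2)) 2
  rw [linearEquiv_apply_eq] at e1 e2 e3 e4 e5
  simp only [bg2, mT09, h0, h1] at e1 e2 e3 e4 e5
  generalize φ (e 0) 0 = a0 at *
  generalize φ (e 0) 1 = a1 at *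
  generalize φ (e 1) 0 = b0 at *
  generalize φ (e 1) 1 = b1 at *
  generalize φ (e 2) 2 = c at *
  simp [e] at e1 e2 e3 e4 e5
  have hβ : β₁ = β₂ * c := mul_right_cancel₀ hc (by linear_combination e5)
  by_cases hb0 : b0 = 0
  · left
    subst hb0
    have ha0 : a0 ≠ 0 := by rintro rfl; simp at hD
    have hb1 : b1 ≠ 0 := by rintro rfl; simp at hD
    have hc1 : c = 1 := mul_left_cancel₀ ha0 (by linear_combination -e1)
    subst hc1
    exact ⟨mul_right_cancel₀ hb1 (by linear_combination -e4), by simp [hβ]⟩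
  · right
    have hc1 : α₁ = c := mul_right_cancel₀ hb0 (by linear_combination e3)
    subst hc1
    have e4' : b1 = b0 + α₂ * b1 := mul_left_cancel₀ hc (by linear_combination e4)
    have hα : 1 - α₁ * α₂ = 0 := by
      refine (mul_eq_zero.mp ?_).resolve_left hD
      grind
    refine ⟨hc, ?_, ?_⟩
    · rw [eq_div_iff hc]; linear_combination -hα
    · rw [eq_div_iff hc, hβ]

theorem statement10 (α₁ α₂ β₁ β₂ : ℂ) :
    IsoPair (mT09 β₁) (bg2 α₁) (mT09 β₂) (bg2 α₂) ↔
    ((α₂ = α₁ ∧ β₂ = β₁) ∨ (α₁ ≠ 0 ∧ α₂ = 1/α₁ ∧ β₂ = β₁/α₁)) := by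
  refine ⟨params_of_isoPair, ?_⟩
  rintro (⟨rfl, rfl⟩ | ⟨hα, rfl, rfl⟩)
  · exact ⟨LinearEquiv.refl ℂ V3, fun _ _ => rfl, fun _ _ => rfl⟩
  · exact isoPair_inv α₁ β₁ hα
end
end

section
/- For α₁, α₂ ∈ ℂ, the transposed Poisson algebras T₁₁^{α₁} and T₁₁^{α₂} are isomorphic if and only if α₂ = α₁, or α₁ ≠ 0 and α₂ = 1/α₁. -/
noncomputable section

def mT11 : V3 → V3 → V3 := fun x y => ![(x 2 * y 2), (0 : ℂ), (0 : ℂ)]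

lemma isoPair_refl {L : Type*} [AddCommGroup L] [Module ℂ L] (m b : L → L → L) :
    IsoPair m b m b :=
  ⟨LinearEquiv.refl ℂ L, fun _ _ => rfl, fun _ _ => rfl⟩

/-- The isomorphism carrying the bracket with parameter `c` to the one with parameter `c⁻¹`. -/
def invParamEquiv (c : ℂ) (hc : c ≠ 0) : V3 ≃ₗ[ℂ] V3 where
  toFun x := ![c ^ 2 * x 0 + (c ^ 3 - c ^ 2) * x 1, c ^ 3 * x 1, c * x 2]
  invFun y := ![(y 0 - (c ^ 3 - c ^ 2) * (y 1 / c ^ 3)) / c ^ 2, y 1 / c ^ 3, y 2 / c]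
  map_add' x y := by
    ext i
    fin_cases i <;> simp <;> ring
  map_smul' a x := by
    ext i
    fin_cases i <;> simp <;> ring
  left_inv x := by
    ext i
    fin_cases i <;> simp <;> field_simp <;> ring
  right_inv y := by
    ext i
    fin_cases i <;> simp <;> field_simp <;> ring

lemma isoPair_inv_param (c : ℂ) (hc : c ≠ 0) :
    IsoPair mT11 (bg2 c) mT11 (bg2 (1 / c)) := by
  refine ⟨invParamEquiv c hc, fun x y => ?_, fun x y => ?_⟩
  · ext i
    fin_cases i <;> simp [invParamEquiv, mT11] <;> ring
  · ext i
    fin_cases i <;> simp [invParamEquiv, bg2] <;> field_simp <;> ring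

lemma param_eq_or_inv_of_isoPair {α₁ α₂ : ℂ}
    (h : IsoPair mT11 (bg2 α₁) mT11 (bg2 α₂)) :
    α₂ = α₁ ∨ (α₁ ≠ 0 ∧ α₂ = 1 / α₁) := by
  obtain ⟨φ, hm, hb⟩ := h
  have m33 : mT11 (e 2) (e 2) = e 0 := by
    ext i
    fin_cases i <;> simp [mT11, e]
  have m23 : mT11 (e 1) (e 2) = 0 := by
    ext i
    fin_cases i <;> simp [mT11, e]
  have b13 : bg2 α₁ (e 0) (e 2) = e 0 + e 1 := by
    ext i
    fin_cases i <;> simp [bg2, e]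
  have b23 : bg2 α₁ (e 1) (e 2) = α₁ • e 1 := by
    ext i
    fin_cases i <;> simp [bg2, e]
  have h33 := hm (e 2) (e 2)
  have h23 := hm (e 1) (e 2)
  have k13 := hb (e 0) (e 2)
  have k23 := hb (e 1) (e 2)
  rw [m33] at h33
  rw [m23, map_zero] at h23
  rw [b13, map_add] at k13
  rw [b23, map_smul] at k23
  set c := φ (e 2) 2 with hc_def
  have hc : c ≠ 0 := by
    intro hc
    have h0 : φ (e 0) = 0 := by
      rw [h33]
      ext i
      fin_cases i <;> simp [mT11, ← hc_def, hc]
    have he : (e 0 : V3) 0 = 0 := by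
      rw [(map_eq_zero_iff φ φ.injective).1 h0]
      rfl
    simp [e] at he
  have a0 : φ (e 0) 0 = c ^ 2 := by
    rw [h33]
    simp [mT11, ← hc_def, sq]
  have a1 : φ (e 0) 1 = 0 := by
    rw [h33]
    simp [mT11]
  have a2 : φ (e 0) 2 = 0 := by
    rw [h33]
    simp [mT11]
  have q2 : φ (e 1) 2 = 0 := by
    have := congrFun h23 0
    simp only [mT11, Pi.zero_apply, Matrix.cons_val_zero, ← hc_def] at this
    exact (mul_eq_zero.1 this.symm).resolve_right hc
  have k130 := congrFun k13 0
  have k131 := congrFun k13 1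
  have k230 := congrFun k23 0
  have k231 := congrFun k23 1
  simp only [bg2, Pi.add_apply, Pi.smul_apply, smul_eq_mul, Matrix.cons_val_zero,
    Matrix.cons_val_one, ← hc_def, a0, a1, a2, q2] at k130 k131 k230 k231
  have hp : φ (e 1) 0 = c ^ 3 - c ^ 2 := by linear_combination k130
  have hq : φ (e 1) 1 = c ^ 3 := by linear_combination k131
  rw [hp] at k230 k231
  rw [hq] at k231
  have hcases : c ^ 2 * ((c - 1) * (c - α₁)) = 0 := by linear_combination -k230
  rcases mul_eq_zero.1 ((mul_eq_zero.1 hcases).resolve_left (pow_ne_zero 2 hc)) with h | h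
  · left
    have h1 : c = 1 := sub_eq_zero.1 h
    rw [h1] at k231
    linear_combination -k231
  · right
    have h1 : c = α₁ := sub_eq_zero.1 h
    rw [← h1] at k231 ⊢
    refine ⟨hc, ?_⟩
    rw [eq_div_iff hc]
    apply mul_left_cancel₀ (pow_ne_zero 3 hc)
    linear_combination -k231

theorem statement11 (α₁ α₂ : ℂ) :
    IsoPair mT11 (bg2 α₁) mT11 (bg2 α₂) ↔
    (α₂ = α₁ ∨ (α₁ ≠ 0 ∧ α₂ = 1/α₁)) := by
  refine ⟨param_eq_or_inv_of_isoPair, ?_⟩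
  rintro (rfl | ⟨h, rfl⟩)
  · exact isoPair_refl _ _
  · exact isoPair_inv_param α₁ h
end
end

section
/- Let · be a commutative associative bilinear multiplication on g₂⁰ (the algebra g₂^α with α = 0, i.e. with only nonzero bracket [e₁,e₃] = e₁ + e₂) such that (g₂⁰, ·, [·,·]) satisfies the transposed Poisson compatibility condition 2 z·[x,y] = [z·x, y] + [x, z·y]. Then (g₂⁰, ·, [·,·]) is isomorphic to exactly one of the following transposed Poisson algebras (only nonzero products listed; in each case the bracket is [e₁,e₃] = e₁ + e₂): T₀₉^{0,β} (β ∈ ℂ): e₁·e₃ = β e₁, e₂·e₃ = β e₂, e₃·e₃ = β e₃; T₁₀⁰: e₃·e₃ = e₂; T₁₁⁰: e₃·e₃ = e₁; T₁₆: e₃·e₃ = e₁ + e₂; T₁₇^β (β ∈ ℂ): e₁·e₁ = e₂, e₁·e₂ = −e₂, e₁·e₃ = β e₁, e₂·e₂ = e₂, e₂·e₃ = β e₂, e₃·e₃ = β e₃; T₁₈: e₁·e₁ = e₂, e₁·e₂ = −e₂, e₂·e₂ = e₂, e₃·e₃ = e₁ + e₂; T₁₉^γ (γ ∈ ℂ,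 γ ≠ 0): e₁·e₃ = γ e₁ + γ e₂, e₃·e₃ = γ e₃. -/
noncomputable section

def mT10 : V3 → V3 → V3 := fun x y => ![(0 : ℂ), (x 2 * y 2), (0 : ℂ)]

def mT16 : V3 → V3 → V3 := fun x y => ![(x 2 * y 2), (x 2 * y 2), (0 : ℂ)]

def mT17 (β : ℂ) : V3 → V3 → V3 := fun x y => ![(β * (x 0 * y 2 + x 2 * y 0)), (x 0 * y 0) + (-(x 0 * y 1 + x 1 * y 0)) + (x 1 * y 1) + (β * (x 1 * y 2 + x 2 * y 1)), (β * (x 2 * y 2))]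

def mT18 : V3 → V3 → V3 := fun x y => ![(x 2 * y 2), (x 0 * y 0) + (-(x 0 * y 1 + x 1 * y 0)) + (x 1 * y 1) + (x 2 * y 2), (0 : ℂ)]

def mT19 (γ : ℂ) : V3 → V3 → V3 := fun x y => ![(γ * (x 0 * y 2 + x 2 * y 0)), (γ * (x 0 * y 2 + x 2 * y 0)), (γ * (x 2 * y 2))]

inductive I13 where
  | t09 (β : ℂ)
  | t10
  | t11
  | t16
  | t17 (β : ℂ)
  | t18
  | t19 (γ : ℂ)

def mulI13 : I13 → V3 → V3 → V3
  | .t09 β => mT09 β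
  | .t10 => mT10
  | .t11 => mT11
  | .t16 => mT16
  | .t17 β => mT17 β
  | .t18 => mT18
  | .t19 γ => mT19 γ

def validI13 : I13 → Prop
  | .t19 γ => γ ≠ 0
  | _ => True

/-- Structure constants of a multiplication on `g₂⁰`, read in the basis `u = e₁ + e₂`, `f = e₂`,
`w = e₃`: `u·w = a u`, `f·f = t f`, `f·w = s f`, `w·w = p u + q f + a w`. -/
structure StructureConstants where
  a : ℂ
  s : ℂ
  t : ℂ
  p : ℂ
  q : ℂ

/-- The multiplication with the given structure constants, in the coordinates of `e₁, e₂, e₃`. -/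
def StructureConstants.mul (P : StructureConstants) : V3 → V3 → V3 := fun x y =>
  ![P.a * (x 0 * y 2 + x 2 * y 0) + P.p * (x 2 * y 2),
    P.a * (x 0 * y 2 + x 2 * y 0) + P.p * (x 2 * y 2) + P.t * ((x 1 - x 0) * (y 1 - y 0))
      + P.s * ((x 1 - x 0) * y 2 + x 2 * (y 1 - y 0)) + P.q * (x 2 * y 2),
    P.a * (x 2 * y 2)]

/-- The structure constants are related by the automorphism
`u ↦ l u`, `f ↦ k f`, `w ↦ w + x u + y f` of `g₂⁰`. -/
def StructureConstants.Related (P Q : StructureConstants) : Prop :=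
  ∃ l k x y : ℂ, l ≠ 0 ∧ k ≠ 0 ∧ P.a = Q.a ∧ P.t = k * Q.t ∧ P.s = Q.s + y * Q.t ∧
    P.p * l = Q.p + x * Q.a ∧ P.q * k + Q.a * y = Q.q + 2 * y * Q.s + y ^ 2 * Q.t

lemma eq_sum_e (x : V3) : x = x 0 • e 0 + (x 1 • e 1 + x 2 • e 2) := by
  ext i
  fin_cases i <;> simp [e]

lemma Bilinear.apply_add_smul {m : V3 → V3 → V3} (hm : Bilinear m) (x y : V3) :
    m x y = x 0 • (y 0 • m (e 0) (e 0) + (y 1 • m (e 0) (e 1) + y 2 • m (e 0) (e 2))) +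
      (x 1 • (y 0 • m (e 1) (e 0) + (y 1 • m (e 1) (e 1) + y 2 • m (e 1) (e 2))) +
        x 2 • (y 0 • m (e 2) (e 0) + (y 1 • m (e 2) (e 1) + y 2 • m (e 2) (e 2)))) := by
  obtain ⟨h1, h2⟩ := hm
  have z1 : ∀ z, m 0 z = 0 := fun z => by simpa using h1 1 0 0 z
  have z2 : ∀ z, m z 0 = 0 := fun z => by simpa using h2 1 z 0 0
  have s1 : ∀ (a : ℂ) x z, m (a • x) z = a • m x z := fun a x z => by
    simpa [z1] using h1 a x 0 z
  have s2 : ∀ (a : ℂ) x z, m z (a • x) = a • m z x := fun a x z => by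
    simpa [z2] using h2 a z x 0
  have right : ∀ z, m z y = y 0 • m z (e 0) + (y 1 • m z (e 1) + y 2 • m z (e 2)) := fun z => by
    conv_lhs => rw [eq_sum_e y]
    rw [h2, h2, s2]
  conv_lhs => rw [eq_sum_e x]
  rw [h1, h1, s1, right, right, right]

lemma exists_structureConstants {m : V3 → V3 → V3} (hm : Bilinear m)
    (hcomm : ∀ x y, m x y = m y x)
    (hassoc : ∀ x y z, m (m x y) z = m x (m y z))
    (hcompat : ∀ x y z, (2 : ℂ) • m z (bg2 0 x y) = bg2 0 (m z x) y + bg2 0 x (m z y)) :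
    ∃ P : StructureConstants, m = P.mul ∧ P.s ^ 2 = P.q * P.t + P.a * P.s := by
  have half : ∀ z, m z (e 1) 0 = 0 ∧ m z (e 1) 2 = 0 ∧ m z (e 0) 2 = 0 ∧
      m z (e 0) 0 = m z (e 2) 2 ∧ m z (e 0) 1 + m z (e 1) 1 = m z (e 2) 2 := by
    intro z
    have z2 : m z 0 = 0 := by simpa using hm.2 1 z 0 0
    have b01 : bg2 0 (e 0) (e 1) = 0 := by ext i; fin_cases i <;> simp [bg2, e]
    have b12 : bg2 0 (e 1) (e 2) = 0 := by ext i; fin_cases i <;> simp [bg2, e]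
    have b02 : bg2 0 (e 0) (e 2) = (1 : ℂ) • e 0 + e 1 := by
      ext i; fin_cases i <;> simp [bg2, e]
    have h01 := hcompat (e 0) (e 1) z
    have h12 := hcompat (e 1) (e 2) z
    have h02 := hcompat (e 0) (e 2) z
    rw [b01, z2] at h01
    rw [b12, z2] at h12
    rw [b02, hm.2] at h02
    have h010 := congrFun h01 0
    have h120 := congrFun h12 0
    have h020 := congrFun h02 0
    have h021 := congrFun h02 1
    have h022 := congrFun h02 2
    simp [bg2, e] at h010 h120 h020 h021 h022
    simp only [← e.eq_def] at h010 h120 h020 h021 h022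
    refine ⟨?_, ?_, ?_, ?_, ?_⟩ <;> grind
  obtain ⟨a1, a2, a3, a4, a5⟩ := half (e 0)
  obtain ⟨b1, b2, b3, b4, b5⟩ := half (e 1)
  obtain ⟨c1, c2, c3, c4, c5⟩ := half (e 2)
  rw [hcomm (e 1) (e 0)] at b3 b4 b5
  rw [hcomm (e 2) (e 0)] at c3 c4 c5
  rw [hcomm (e 2) (e 1)] at c1 c2 c5
  have hP : m = StructureConstants.mul ⟨m (e 2) (e 2) 2, m (e 1) (e 2) 1, m (e 1) (e 1) 1,
      m (e 2) (e 2) 0, m (e 2) (e 2) 1 - m (e 2) (e 2) 0⟩ := by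
    funext x y
    rw [hm.apply_add_smul, hcomm (e 1) (e 0), hcomm (e 2) (e 0), hcomm (e 2) (e 1)]
    ext i
    fin_cases i <;> simp [StructureConstants.mul] <;> grind
  refine ⟨_, hP, ?_⟩
  have h := congrFun (hassoc (e 1) (e 2) (e 2)) 1
  generalize m (e 2) (e 2) 2 = a, m (e 1) (e 2) 1 = s, m (e 1) (e 1) 1 = t,
    m (e 2) (e 2) 0 = p, m (e 2) (e 2) 1 - m (e 2) (e 2) 0 = q at hP
  subst hP
  simp [StructureConstants.mul, e] at h ⊢
  linear_combination h

lemma related_of_isoPair {P Q : StructureConstants}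
    (h : IsoPair P.mul (bg2 0) Q.mul (bg2 0)) : P.Related Q := by
  obtain ⟨φ, hmul, hbr⟩ := h
  have b02 : bg2 0 (e 0) (e 2) = e 0 + e 1 := by ext i; fin_cases i <;> simp [bg2, e]
  have b1 : ∀ y, bg2 0 (e 1) y = 0 := fun y => by ext i; fin_cases i <;> simp [bg2, e]
  have hf : ∀ y, bg2 0 (φ (e 1)) y = 0 := fun y => by
    simpa [b1] using (hbr (e 1) (φ.symm y)).symm
  have f2 : φ (e 1) 2 = 0 := by simpa [bg2, e] using congrFun (hf (e 0)) 0
  have f0 : φ (e 1) 0 = 0 := by simpa [bg2, e] using congrFun (hf (e 2)) 0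
  have hu := hbr (e 0) (e 2)
  rw [b02, map_add] at hu
  have hu0 := congrFun hu 0
  have hu1 := congrFun hu 1
  have hu2 := congrFun hu 2
  simp [bg2, f0, f2] at hu0 hu1 hu2
  have hk : φ (e 1) 1 ≠ 0 := by
    intro h0
    have : φ (e 1) = 0 := by ext i; fin_cases i <;> simp [f0, f2, h0]
    have := congrFun (φ.map_eq_zero_iff.mp this) 1
    simp [e] at this
  have hl : φ (e 0) 0 ≠ 0 := by
    intro h0
    have : φ (e 0 + e 1) = 0 := by
      rw [map_add]
      ext i; fin_cases i <;> simp [f0, f2] <;> grind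
    have := congrFun (φ.map_eq_zero_iff.mp this) 0
    simp [e] at this
  have hw : φ (e 2) 2 = 1 := by
    rw [hu2] at hu0
    exact mul_left_cancel₀ hl (by linear_combination -hu0)
  have p11 : P.mul (e 1) (e 1) = P.t • e 1 := by
    ext i; fin_cases i <;> simp [StructureConstants.mul, e]
  have p12 : P.mul (e 1) (e 2) = P.s • e 1 := by
    ext i; fin_cases i <;> simp [StructureConstants.mul, e]
  have p22 : P.mul (e 2) (e 2) = P.p • (e 0 + e 1) + P.q • e 1 + P.a • e 2 := by
    ext i; fin_cases i <;> simp [StructureConstants.mul, e]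
  have m11 := hmul (e 1) (e 1)
  have m12 := hmul (e 1) (e 2)
  have m22 := hmul (e 2) (e 2)
  rw [p11, map_smul] at m11
  rw [p12, map_smul] at m12
  rw [p22] at m22
  simp only [map_add, map_smul] at m22
  have m11 := congrFun m11 1
  have m12 := congrFun m12 1
  have m220 := congrFun m22 0
  have m221 := congrFun m22 1
  have m222 := congrFun m22 2
  simp [StructureConstants.mul, f0, f2, hu2, hw] at m11 m12 m220 m221 m222
  refine ⟨φ (e 0) 0, φ (e 1) 1, φ (e 2) 0, φ (e 2) 1 - φ (e 2) 0, hl, hk, m222, ?_, ?_, ?_, ?_⟩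
  · exact mul_right_cancel₀ hk (by linear_combination m11)
  · exact mul_right_cancel₀ hk (by linear_combination m12)
  · rw [m222] at m220
    linear_combination m220
  · have hu1' : φ (e 0) 1 + φ (e 1) 1 = φ (e 0) 0 := by
      rw [hu1, hw, hu2]; ring
    rw [m222] at m220 m221
    linear_combination m221 - m220 - P.p * hu1'

lemma isoPair_of_related {P Q : StructureConstants} (h : P.Related Q) :
    IsoPair P.mul (bg2 0) Q.mul (bg2 0) := by
  obtain ⟨l, k, x, y, hl, hk, ha, ht, hs, hp, hq⟩ := h
  refine ⟨{ toFun := fun v =>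
              ![l * v 0 + x * v 2, l * v 0 + k * (v 1 - v 0) + (x + y) * v 2, v 2]
            invFun := fun v =>
              ![(v 0 - x * v 2) / l, (v 0 - x * v 2) / l + (v 1 - v 0 - y * v 2) / k, v 2]
            map_add' := fun v w => by ext i; fin_cases i <;> simp <;> ring
            map_smul' := fun c v => by ext i; fin_cases i <;> simp <;> ring
            left_inv := fun v => by ext i; fin_cases i <;> simp <;> field_simp; ring
            right_inv := fun v => by ext i; fin_cases i <;> simp <;> field_simp <;> ring },
    fun v w => ?_, fun v w => ?_⟩
  · ext i
    fin_cases i <;> simp [StructureConstants.mul]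
    · rw [ha]; linear_combination (v 2 * w 2) * hp
    · rw [ha, hs, ht]
      linear_combination (v 2 * w 2) * (hp + hq)
    · simp [ha]
  · ext i
    fin_cases i <;> simp [bg2] <;> ring

/-- The structure constants of the algebras in the classification. -/
def I13.structureConstants : I13 → StructureConstants
  | .t09 β => ⟨β, β, 0, 0, 0⟩
  | .t10 => ⟨0, 0, 0, 0, 1⟩
  | .t11 => ⟨0, 0, 0, 1, -1⟩
  | .t16 => ⟨0, 0, 0, 1, 0⟩
  | .t17 β => ⟨β, β, 1, 0, 0⟩
  | .t18 => ⟨0, 0, 1, 1, 0⟩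
  | .t19 γ => ⟨γ, 0, 0, 0, 0⟩

lemma mulI13_eq (i : I13) : mulI13 i = i.structureConstants.mul := by
  funext x y
  cases i <;> ext j <;> fin_cases j <;>
    simp [mulI13, I13.structureConstants, StructureConstants.mul, mT09, mT10, mT11, mT16, mT17,
      mT18, mT19] <;> ring

lemma exists_related {P : StructureConstants} (hP : P.s ^ 2 = P.q * P.t + P.a * P.s) :
    ∃ i : I13, validI13 i ∧ P.Related i.structureConstants := by
  obtain ⟨a, s, t, p, q⟩ := P
  simp only at hP
  by_cases ht : t = 0
  · subst ht
    by_cases ha : a = 0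
    · subst ha
      obtain rfl : s = 0 := by simpa using hP
      by_cases hp : p = 0 <;> by_cases hq : q = 0
      · exact ⟨.t09 0, trivial, 1, 1, 0, 0, by simp [I13.structureConstants, hp, hq]⟩
      · exact ⟨.t10, trivial, 1, q⁻¹, 0, 0, by simp [I13.structureConstants, hp, hq]⟩
      · exact ⟨.t16, trivial, p⁻¹, 1, 0, 0, by simp [I13.structureConstants, hp, hq]⟩
      · exact ⟨.t11, trivial, p⁻¹, -q⁻¹, 0, 0, by simp [I13.structureConstants, hp, hq]⟩
    · by_cases hs : s = 0
      · exact ⟨.t19 a, ha, 1, 1, p / a, -q / a, one_ne_zero, one_ne_zero, rfl, by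
          simp [I13.structureConstants, hs]; field_simp; simp⟩
      · obtain rfl : s = a := mul_right_cancel₀ hs (by linear_combination hP)
        exact ⟨.t09 s, trivial, 1, 1, p / s, q / s, one_ne_zero, one_ne_zero, rfl, by
          simp [I13.structureConstants]; field_simp; norm_num⟩
  · have hq : q * t + a * (s - a) = 2 * (s - a) * a + (s - a) ^ 2 := by linear_combination -hP
    by_cases ha : a = 0
    · subst ha
      by_cases hp : p = 0
      · exact ⟨.t17 0, trivial, 1, t, 0, s, by simp [I13.structureConstants, ht, hp]; grind⟩
      · exact ⟨.t18, trivial, p⁻¹, t, 0, s, by simp [I13.structureConstants, ht, hp]; grind⟩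
    · exact ⟨.t17 a, trivial, 1, t, p / a, s - a, by
        simp [I13.structureConstants, ht, ha]; grind⟩

lemma eq_of_related {P : StructureConstants} {i j : I13} (vi : validI13 i) (vj : validI13 j)
    (hi : P.Related i.structureConstants) (hj : P.Related j.structureConstants) : i = j := by
  obtain ⟨a, s, t, p, q⟩ := P
  obtain ⟨l, k, x, y, hl, hk, h1, h2, h3, h4, h5⟩ := hi
  obtain ⟨l', k', x', y', hl', hk', h1', h2', h3', h4', h5'⟩ := hj
  cases i <;> cases j <;> simp [I13.structureConstants, validI13] at * <;> grind

theorem statement13 (m : V3 → V3 → V3)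
    (hm : Bilinear m)
    (hcomm : ∀ x y, m x y = m y x)
    (hassoc : ∀ x y z, m (m x y) z = m x (m y z))
    (hcompat : ∀ x y z, (2 : ℂ) • m z (bg2 0 x y) = bg2 0 (m z x) y + bg2 0 x (m z y)) :
    ∃! i : I13, validI13 i ∧ IsoPair m (bg2 0) (mulI13 i) (bg2 0) := by
  obtain ⟨P, rfl, hP⟩ := exists_structureConstants hm hcomm hassoc hcompat
  simp only [mulI13_eq]
  obtain ⟨i, hi, hr⟩ := exists_related hP
  exact ⟨i, ⟨hi, isoPair_of_related hr⟩, fun j ⟨hj, hr'⟩ =>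
    eq_of_related hj hi (related_of_isoPair hr') hr⟩
end
end
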